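/- Let G be a graph with a nonnegative real weight function w on its vertices and let (X1, X2) be an even 2-join of G with associated sets A1, B1, C1, A2, B2, C2, i.e. a 2-join such that every chordless path of G[X1] from a vertex of A1 to a vertex of B1 with all internal vertices in C1 has even length. Then α_AC + α_BC ≤ α_C + α_X. -/

import Mathlib

open SimpleGraph

/-- A 2-join `(X1, X2)` of `G` with split sets `A1, B1 ⊆ X1` and `A2, B2 ⊆ X2`. -/
def IsTwoJoin {V : Type} [Fintype V] [DecidableEq V] (G : SimpleGraph V)
    (X1 X2 A1 B1 A2 B2 : Finset V) : Prop :=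
  Disjoint X1 X2 ∧ X1 ∪ X2 = Finset.univ ∧
  A1 ⊆ X1 ∧ B1 ⊆ X1 ∧ A2 ⊆ X2 ∧ B2 ⊆ X2 ∧
  A1.Nonempty ∧ B1.Nonempty ∧ A2.Nonempty ∧ B2.Nonempty ∧
  Disjoint A1 B1 ∧ Disjoint A2 B2 ∧
  (∀ x ∈ X1, ∀ y ∈ X2, G.Adj x y ↔ ((x ∈ A1 ∧ y ∈ A2) ∨ (x ∈ B1 ∧ y ∈ B2))) ∧
  3 ≤ X1.card ∧ 3 ≤ X2.card ∧
  (∀ v (hv : v ∈ X1),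
    (∃ a, ∃ ha : a ∈ X1, a ∈ A1 ∧
      (G.induce (X1 : Set V)).Reachable ⟨v, hv⟩ ⟨a, ha⟩) ∧
    (∃ c, ∃ hc : c ∈ X1, c ∈ B1 ∧
      (G.induce (X1 : Set V)).Reachable ⟨v, hv⟩ ⟨c, hc⟩)) ∧
  (∀ v (hv : v ∈ X2),
    (∃ a, ∃ ha : a ∈ X2, a ∈ A2 ∧
      (G.induce (X2 : Set V)).Reachable ⟨v, hv⟩ ⟨a, ha⟩) ∧
    (∃ c, ∃ hc : c ∈ X2, c ∈ B2 ∧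
      (G.induce (X2 : Set V)).Reachable ⟨v, hv⟩ ⟨c, hc⟩)) ∧
  ¬ (∃ p q r : V, A1 = {p} ∧ B1 = {r} ∧ X1 = {p, q, r} ∧
      p ≠ q ∧ q ≠ r ∧ p ≠ r ∧ G.Adj p q ∧ G.Adj q r ∧ ¬ G.Adj p r) ∧
  ¬ (∃ p q r : V, A2 = {p} ∧ B2 = {r} ∧ X2 = {p, q, r} ∧
      p ≠ q ∧ q ≠ r ∧ p ≠ r ∧ G.Adj p q ∧ G.Adj q r ∧ ¬ G.Adj p r)

/-- A stable (independent) finite set of vertices. -/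
def IsStableFinset {V : Type} (G : SimpleGraph V) (S : Finset V) : Prop :=
  ∀ a ∈ S, ∀ b ∈ S, ¬ G.Adj a b

/-- The maximum weight of a stable set of `G` contained in `X`. -/
noncomputable def maxStableWeight {V : Type} (G : SimpleGraph V) (w : V → ℝ)
    (X : Finset V) : ℝ :=
  sSup {r : ℝ | ∃ S : Finset V, S ⊆ X ∧ IsStableFinset G S ∧ r = ∑ v ∈ S, w v}

/-- `f 0, …, f n` is a walk of `G` inside `U`. -/
def IsWalkSeq {V : Type} (G : SimpleGraph V) (U : Set V) (n : ℕ) (f : ℕ → V) : Prop :=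
  (∀ i < n, G.Adj (f i) (f (i + 1))) ∧ ∀ i ≤ n, f i ∈ U

namespace IsWalkSeq

variable {V : Type} {G : SimpleGraph V} {U : Set V} {n : ℕ} {f : ℕ → V}

lemma take (h : IsWalkSeq G U n f) {i : ℕ} (hi : i ≤ n) : IsWalkSeq G U i f :=
  ⟨fun k hk => h.1 k (by omega), fun k hk => h.2 k (by omega)⟩

lemma drop (h : IsWalkSeq G U n f) {i : ℕ} (hi : i ≤ n) :
    IsWalkSeq G U (n - i) (fun k => f (k + i)) :=
  ⟨fun k hk => by
    have := h.1 (k + i) (by omega)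
    rwa [show k + i + 1 = k + 1 + i by omega] at this,
   fun k hk => h.2 (k + i) (by omega)⟩

lemma snoc (h : IsWalkSeq G U n f) {b : V} (hb : b ∈ U) (hadj : G.Adj (f n) b) :
    IsWalkSeq G U (n + 1) (fun k => if k ≤ n then f k else b) := by
  refine ⟨fun k hk => ?_, fun k hk => ?_⟩
  · rcases Nat.lt_succ_iff_lt_or_eq.mp hk with hk' | rfl
    · simpa [hk'.le, Nat.succ_le_of_lt hk'] using h.1 k hk'
    · simpa using hadj
  · by_cases hk' : k ≤ n
    · simpa [hk'] using h.2 k hk'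
    · simpa [hk'] using hb

/-- Short-cutting a walk along a chord from `f i` to `f j`. -/
lemma shortcut (h : IsWalkSeq G U n f) {i j : ℕ} (hij : i < j) (hj : j ≤ n)
    (hadj : G.Adj (f i) (f j)) :
    IsWalkSeq G U (n - (j - i - 1)) (fun k => if k ≤ i then f k else f (k + (j - i - 1))) := by
  refine ⟨fun k hk => ?_, fun k hk => ?_⟩
  · rcases lt_trichotomy k i with hk' | rfl | hk'
    · simpa [hk'.le, Nat.succ_le_of_lt hk'] using h.1 k (by omega)
    · simpa [show k + 1 + (j - k - 1) = j by omega] using hadj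
    · have := h.1 (k + (j - i - 1)) (by omega)
      simpa [show ¬ k ≤ i by omega, show ¬ k + 1 ≤ i by omega,
        show k + 1 + (j - i - 1) = k + (j - i - 1) + 1 by omega] using this
  · by_cases hk' : k ≤ i
    · simpa [hk'] using h.2 k (by omega)
    · simpa [hk'] using h.2 (k + (j - i - 1)) (by omega)

/-- Cutting out the closed part of a walk between two equal vertices. -/
lemma cut (h : IsWalkSeq G U n f) {i j : ℕ} (hij : i < j) (hj : j ≤ n) (heq : f i = f j) :
    IsWalkSeq G U (n - (j - i)) (fun k => if k ≤ i then f k else f (k + (j - i))) := by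
  refine ⟨fun k hk => ?_, fun k hk => ?_⟩
  · rcases lt_trichotomy k i with hk' | rfl | hk'
    · simpa [hk'.le, Nat.succ_le_of_lt hk'] using h.1 k (by omega)
    · have := h.1 j (by omega)
      simpa [show k + 1 + (j - k) = j + 1 by omega, heq] using this
    · have := h.1 (k + (j - i)) (by omega)
      simpa [show ¬ k ≤ i by omega, show ¬ k + 1 ≤ i by omega,
        show k + 1 + (j - i) = k + (j - i) + 1 by omega] using this
  · by_cases hk' : k ≤ i
    · simpa [hk'] using h.2 k (by omega)
    · simpa [hk'] using h.2 (k + (j - i)) (by omega)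

/-- In the union of two stable sets, walks alternate between them. -/
lemma mem_of_parity {S T : Finset V} (hS : IsStableFinset G S) (hT : IsStableFinset G T)
    (h : IsWalkSeq G {v | v ∈ S ∨ v ∈ T} n f) (h0 : f 0 ∈ S) :
    ∀ i ≤ n, (Even i → f i ∈ S) ∧ (¬ Even i → f i ∈ T) := by
  intro i
  induction i with
  | zero => simp [h0]
  | succ i ih =>
    intro hi
    obtain ⟨h1, h2⟩ := ih (by omega)
    have hadj := h.1 i (by omega)
    have hmem : f (i + 1) ∈ S ∨ f (i + 1) ∈ T := h.2 (i + 1) hi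
    constructor
    · intro he
      exact hmem.resolve_right fun hc => hT _ (h2 (Nat.even_add_one.mp he)) _ hc hadj
    · intro he
      exact hmem.resolve_left fun hc => hS _ (h1 (by simpa [Nat.even_add_one] using he)) _ hc hadj

end IsWalkSeq

/-- If some walk inside `U` joins `P` to `Q`, a shortest one is a chordless path whose internal
vertices avoid `P` and `Q`. -/
lemma exists_chordless_walkSeq {V : Type} {G : SimpleGraph V} {U P Q : Set V}
    (hex : ∃ n f, IsWalkSeq G U n f ∧ f 0 ∈ P ∧ f n ∈ Q) :
    ∃ n f, IsWalkSeq G U n f ∧ f 0 ∈ P ∧ f n ∈ Q ∧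
      (∀ i j, i < j → j ≤ n → f i ≠ f j) ∧
      (∀ i j, i < j → j ≤ n → G.Adj (f i) (f j) → j = i + 1) ∧
      ∀ i, 0 < i → i < n → f i ∉ P ∧ f i ∉ Q := by
  classical
  obtain ⟨f, hf, h0, hn⟩ := Nat.find_spec hex
  have hmin : ∀ m f, IsWalkSeq G U m f → f 0 ∈ P → f m ∈ Q → Nat.find hex ≤ m :=
    fun m f h1 h2 h3 => Nat.find_min' hex ⟨f, h1, h2, h3⟩
  generalize Nat.find hex = n at *
  refine ⟨n, f, hf, h0, hn, fun i j hij hj heq => ?_, fun i j hij hj hadj => ?_,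
    fun i hi hin => ⟨fun hP => ?_, fun hQ => ?_⟩⟩
  · have := hmin _ _ (hf.cut hij hj heq) (by simpa using h0) (by
      by_cases hjn : j = n
      · subst hjn
        simpa [show j - (j - i) = i by omega, heq] using hn
      · simpa [show ¬ n - (j - i) ≤ i by omega, show n - (j - i) + (j - i) = n by omega] using hn)
    omega
  · by_contra hne
    have := hmin _ _ (hf.shortcut hij hj hadj) (by simpa using h0) (by
      simpa only [show ¬ n - (j - i - 1) ≤ i by omega, if_false,
        show n - (j - i - 1) + (j - i - 1) = n by omega] using hn)
    omega
  · have := hmin _ _ (hf.drop hin.le) (by simpa using hP)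
      (by simpa [Nat.sub_add_cancel hin.le] using hn)
    omega
  · have := hmin _ _ (hf.take hin.le) h0 hQ
    omega

/-- A chordless sequence of distinct vertices is an induced copy of a path graph. -/
def pathGraphEmbedding {V : Type} {G : SimpleGraph V} (n : ℕ) (f : ℕ → V)
    (hadj : ∀ i < n, G.Adj (f i) (f (i + 1)))
    (hinj : ∀ i j, i < j → j ≤ n → f i ≠ f j)
    (hchord : ∀ i j, i < j → j ≤ n → G.Adj (f i) (f j) → j = i + 1) :
    pathGraph (n + 1) ↪g G where
  toFun x := f x
  inj' x y hxy := by
    rcases lt_trichotomy x.val y.val with h | h | h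
    · exact absurd hxy (hinj _ _ h (by omega))
    · exact Fin.ext h
    · exact absurd hxy.symm (hinj _ _ h (by omega))
  map_rel_iff' := by
    intro x y
    change G.Adj (f x) (f y) ↔ _
    rw [pathGraph_adj]
    constructor
    · intro h
      rcases lt_trichotomy x.val y.val with hlt | heq | hlt
      · exact Or.inl (hchord _ _ hlt (by omega) h).symm
      · rw [heq] at h
        exact absurd h (G.irrefl)
      · exact Or.inr (hchord _ _ hlt (by omega) h.symm).symm
    · rintro (h | h)
      · rw [← h]
        exact hadj _ (by omega)
      · rw [← h]
        exact (hadj _ (by omega)).symm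

section MaxStableWeight

variable {V : Type} [Fintype V] (G : SimpleGraph V) (w : V → ℝ) (X : Finset V)

lemma finite_stableWeights :
    {r : ℝ | ∃ S : Finset V, S ⊆ X ∧ IsStableFinset G S ∧ r = ∑ v ∈ S, w v}.Finite :=
  (Set.finite_range fun S : Finset V => ∑ v ∈ S, w v).subset
    fun _ ⟨S, _, _, h⟩ => ⟨S, h.symm⟩

lemma exists_eq_maxStableWeight :
    ∃ S : Finset V, S ⊆ X ∧ IsStableFinset G S ∧ maxStableWeight G w X = ∑ v ∈ S, w v :=
  (show Set.Nonempty {r : ℝ | ∃ S : Finset V, S ⊆ X ∧ IsStableFinset G S ∧ r = ∑ v ∈ S, w v} from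
    ⟨0, ∅, by simp, by simp [IsStableFinset], by simp⟩).csSup_mem (finite_stableWeights G w X)

variable {G X} in
lemma sum_le_maxStableWeight {S : Finset V} (hX : S ⊆ X) (hS : IsStableFinset G S) :
    ∑ v ∈ S, w v ≤ maxStableWeight G w X :=
  le_csSup (finite_stableWeights G w X).bddAbove ⟨S, hX, hS, rfl⟩

end MaxStableWeight

/-- Swapping two stable sets on a set closed under adjacency in their union. -/
lemma IsStableFinset.swap {V : Type} [DecidableEq V] {G : SimpleGraph V} {S T : Finset V}
    (hS : IsStableFinset G S) (hT : IsStableFinset G T) (Y : V → Prop) [DecidablePred Y]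
    (hY : ∀ a b, Y a → (b ∈ S ∨ b ∈ T) → G.Adj a b → Y b) :
    IsStableFinset G (S.filter (fun v => ¬ Y v) ∪ T.filter Y) := by
  intro a ha b hb hab
  simp only [Finset.mem_union, Finset.mem_filter] at ha hb
  rcases ha with ⟨ha, hya⟩ | ⟨ha, hya⟩ <;> rcases hb with ⟨hb, hyb⟩ | ⟨hb, hyb⟩
  · exact hS a ha b hb hab
  · exact hya (hY b a hyb (Or.inl ha) hab.symm)
  · exact hyb (hY a b hya (Or.inl hb) hab)
  · exact hT a ha b hb hab

/-- For an even 2-join (every chordless path of `G[X1]` from `A1` to `B1` with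
internal vertices in `C1 = X1 \ (A1 ∪ B1)` has even length),
`α_AC + α_BC ≤ α_C + α_X` (Trotignon and Vušković). -/
theorem even_two_join_stable_set_inequality {V : Type} [Fintype V]
    [DecidableEq V] (G : SimpleGraph V) (w : V → ℝ) (hw : ∀ v, 0 ≤ w v)
    (X1 X2 A1 B1 A2 B2 : Finset V) (h2j : IsTwoJoin G X1 X2 A1 B1 A2 B2)
    (heven : ∀ (m : ℕ) (hm : 2 ≤ m) (g : pathGraph m ↪g G),
        (∀ x : Fin m, (g x : V) ∈ X1) →
        (g ⟨0, by omega⟩ : V) ∈ A1 → (g ⟨m - 1, by omega⟩ : V) ∈ B1 →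
        (∀ x : Fin m, x.val ≠ 0 → x.val ≠ m - 1 → (g x : V) ∈ X1 \ (A1 ∪ B1)) →
        Even (m - 1)) :
    maxStableWeight G w (A1 ∪ (X1 \ (A1 ∪ B1))) +
      maxStableWeight G w (B1 ∪ (X1 \ (A1 ∪ B1))) ≤
    maxStableWeight G w (X1 \ (A1 ∪ B1)) + maxStableWeight G w X1 := by
  classical
  obtain ⟨-, -, hA, hB, -, -, -, -, -, -, hAB, -⟩ := h2j
  obtain ⟨S, hSX, hS, hSw⟩ := exists_eq_maxStableWeight G w (A1 ∪ (X1 \ (A1 ∪ B1)))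
  obtain ⟨T, hTX, hT, hTw⟩ := exists_eq_maxStableWeight G w (B1 ∪ (X1 \ (A1 ∪ B1)))
  have hAB' : ∀ v ∈ A1, v ∉ B1 := fun _ h => Finset.disjoint_left.mp hAB h
  have hSmem : ∀ v ∈ S, v ∈ X1 ∧ v ∉ B1 := by
    intro v hv
    rcases Finset.mem_union.mp (hSX hv) with h | h
    · exact ⟨hA h, hAB' v h⟩
    · simp only [Finset.mem_sdiff, Finset.mem_union, not_or] at h
      exact ⟨h.1, h.2.2⟩
  have hTmem : ∀ v ∈ T, v ∈ X1 ∧ v ∉ A1 := by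
    intro v hv
    rcases Finset.mem_union.mp (hTX hv) with h | h
    · exact ⟨hB h, fun h' => hAB' v h' h⟩
    · simp only [Finset.mem_sdiff, Finset.mem_union, not_or] at h
      exact ⟨h.1, h.2.1⟩
  have hno : ¬ ∃ n f, IsWalkSeq G {v | v ∈ S ∨ v ∈ T} n f ∧
      f 0 ∈ (A1 : Set V) ∧ f n ∈ (B1 : Set V) := by
    intro hex
    obtain ⟨n, f, hf, h0, hn, hinj, hchord, hint⟩ := exists_chordless_walkSeq hex
    simp only [Finset.mem_coe] at h0 hn hint
    have hX : ∀ i ≤ n, f i ∈ X1 := fun i hi =>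
      (hf.2 i hi).elim (fun h => (hSmem _ h).1) (fun h => (hTmem _ h).1)
    have h0S : f 0 ∈ S := (hf.2 0 (Nat.zero_le n)).resolve_right fun h => (hTmem _ h).2 h0
    have hodd : ¬ Even n := fun he =>
      (hSmem _ ((hf.mem_of_parity hS hT h0S n le_rfl).1 he)).2 hn
    have hpos : n ≠ 0 := by
      rintro rfl
      exact hodd Even.zero
    refine hodd (heven (n + 1) (by omega) (pathGraphEmbedding n f hf.1 hinj hchord)
      (fun x => hX x (by omega)) h0 hn fun x hx0 hxn => ?_)
    have := hint x (by omega) (by omega)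
    simp only [Finset.mem_sdiff, Finset.mem_union, not_or]
    exact ⟨hX x (by omega), this⟩
  let Y : V → Prop := fun v => ∃ n f, IsWalkSeq G {v | v ∈ S ∨ v ∈ T} n f ∧
      f 0 ∈ (A1 : Set V) ∧ f n = v
  have hYB : ∀ v, Y v → v ∉ B1 := fun v ⟨n, f, hf, h0, hn⟩ hv =>
    hno ⟨n, f, hf, h0, by rw [hn]; exact hv⟩
  have hYA : ∀ v ∈ S, v ∈ A1 → Y v := fun v hv hvA =>
    ⟨0, fun _ => v, ⟨fun i hi => absurd hi (Nat.not_lt_zero i), fun _ _ => Or.inl hv⟩, hvA, rfl⟩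
  have hYclosed : ∀ a b, Y a → (b ∈ S ∨ b ∈ T) → G.Adj a b → Y b := by
    rintro a b ⟨n, f, hf, h0, rfl⟩ hb hab
    exact ⟨n + 1, _, hf.snoc hb hab, by simpa using h0, by simp⟩
  have hS' := hS.swap hT Y hYclosed
  have hT' := hT.swap hS Y fun a b h1 h2 => hYclosed a b h1 h2.symm
  have key := add_le_add
    (sum_le_maxStableWeight w (X := X1 \ (A1 ∪ B1)) (by
      intro v hv
      simp only [Finset.mem_union, Finset.mem_filter] at hv
      simp only [Finset.mem_sdiff, Finset.mem_union, not_or]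
      rcases hv with ⟨hv, hy⟩ | ⟨hv, hy⟩
      · exact ⟨(hSmem v hv).1, fun h => hy (hYA v hv h), (hSmem v hv).2⟩
      · exact ⟨(hTmem v hv).1, (hTmem v hv).2, hYB v hy⟩) hS')
    (sum_le_maxStableWeight w (X := X1) (by
      intro v hv
      simp only [Finset.mem_union, Finset.mem_filter] at hv
      rcases hv with ⟨hv, -⟩ | ⟨hv, -⟩
      · exact (hTmem v hv).1
      · exact (hSmem v hv).1) hT')
  have hdisj : ∀ P Q : Finset V, Disjoint (P.filter fun v => ¬ Y v) (Q.filter Y) := by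
    intro P Q
    rw [Finset.disjoint_left]
    intro v h1 h2
    exact (Finset.mem_filter.mp h1).2 (Finset.mem_filter.mp h2).2
  rw [Finset.sum_union (hdisj S T), Finset.sum_union (hdisj T S)] at key
  rw [hSw, hTw, ← Finset.sum_filter_add_sum_filter_not S Y,
    ← Finset.sum_filter_add_sum_filter_not T Y]
  linarith
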